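/- Every bridgeless chordal (triangulated) graph admits a nowhere-zero 4-flow, i.e., an orientation together with a map φ: E → Z_4 \ {0} satisfying flow conservation modulo 4 at each vertex. -/

import Mathlib

/-- A simple graph is chordal (triangulated) if every cycle of length at least 4
has a chord. -/
def IsChordal {V : Type} (G : SimpleGraph V) : Prop :=
  ∀ ⦃v : V⦄ (w : G.Walk v v), w.IsCycle → 4 ≤ w.length →
    ∃ u x : V, u ∈ w.support ∧ x ∈ w.support ∧ G.Adj u x ∧ s(u, x) ∉ w.edges

open SimpleGraph in
/-- Every edge of a cycle with a chord lies on a strictly shorter cycle. -/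
theorem SimpleGraph.Walk.IsCycle.exists_shorter_of_chord {V : Type*} {G : SimpleGraph V} {v : V}
    {w : G.Walk v v} (hw : w.IsCycle) {e : Sym2 V} (he : e ∈ w.edges) {u x : V}
    (hu : u ∈ w.support) (hx : x ∈ w.support) (hux : G.Adj u x) (hchord : s(u, x) ∉ w.edges) :
    ∃ (z : V) (c : G.Walk z z), c.IsCycle ∧ e ∈ c.edges ∧ c.length < w.length := by
  classical
  obtain ⟨c, hc, hce, hcl, hcx⟩ : ∃ c : G.Walk u u, c.IsCycle ∧ (∀ e, e ∈ c.edges ↔ e ∈ w.edges) ∧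
      c.length = w.length ∧ x ∈ c.support :=
    ⟨w.rotate u hu, hw.rotate hu, fun e => (w.rotate_edges u hu).mem_iff, by simp, by simpa using hx⟩
  rw [← hcl]
  rw [← hce] at he hchord
  have hspec := c.take_spec hcx
  have hlen := congrArg Walk.length hspec
  rw [Walk.length_append] at hlen
  have hedges := congrArg Walk.edges hspec
  rw [Walk.edges_append] at hedges
  have hp : (c.takeUntil x hcx).IsPath := hc.isPath_takeUntil hcx
  have hq : (c.dropUntil x hcx).IsPath := by
    rw [← hspec] at hc
    exact hc.isPath_of_append_right (fun h => hux.ne (Walk.Nil.eq h))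
  generalize c.takeUntil x hcx = p at *
  generalize c.dropUntil x hcx = q at *
  have hp1 : s(u, x) ∉ p.edges := fun h => hchord (by simp [← hedges, h])
  have hq1 : s(u, x) ∉ q.edges := fun h => hchord (by simp [← hedges, h])
  have hp2 : 2 ≤ p.length := by
    rcases p with _ | ⟨h, _ | ⟨h', r⟩⟩
    · exact (G.loopless.irrefl _ hux).elim
    · simp at hp1
    · simp
  have hq2 : 2 ≤ q.length := by
    rcases q with _ | ⟨h, _ | ⟨h', r⟩⟩
    · exact (G.loopless.irrefl _ hux).elim
    · simp [Sym2.eq_swap] at hq1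
    · simp
  rw [← hedges, List.mem_append] at he
  rcases he with he | he
  · refine ⟨x, .cons hux.symm p, ?_, by simp [he], by rw [Walk.length_cons]; omega⟩
    rw [Walk.cons_isCycle_iff, Sym2.eq_swap]
    exact ⟨hp, hp1⟩
  · refine ⟨u, .cons hux q, ?_, by simp [he], by rw [Walk.length_cons]; omega⟩
    rw [Walk.cons_isCycle_iff]
    exact ⟨hq, hq1⟩

open SimpleGraph in
/-- In a chordal graph, an edge on a cycle lies in a triangle. -/
theorem IsChordal.exists_triangle_of_mem_edges_cycle {V : Type} {G : SimpleGraph V}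
    (hG : IsChordal G) {a b v : V} (w : G.Walk v v) (hw : w.IsCycle) (he : s(a, b) ∈ w.edges) :
    ∃ c, G.Adj b c ∧ G.Adj c a := by
  induction hn : w.length using Nat.strong_induction_on generalizing v with
  | _ n ih =>
    subst hn
    by_cases h4 : 4 ≤ w.length
    · obtain ⟨u, x, hu, hx, hux, hchord⟩ := hG w hw h4
      obtain ⟨z, c, hc, hec, hlt⟩ := hw.exists_shorter_of_chord he hu hx hux hchord
      exact ih c.length hlt c hc hec rfl
    · have h3 := hw.three_le_length
      rcases w with _ | ⟨h₁, _ | ⟨h₂, _ | ⟨h₃, _ | ⟨h₄, r⟩⟩⟩⟩ <;> simp at h3 h4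
      simp only [Walk.edges_cons, Walk.edges_nil, List.mem_cons, List.not_mem_nil, or_false,
        Sym2.eq_iff] at he
      rcases he with (⟨rfl, rfl⟩ | ⟨rfl, rfl⟩) | (⟨rfl, rfl⟩ | ⟨rfl, rfl⟩) | ⟨rfl, rfl⟩ | ⟨rfl, rfl⟩ <;>
        first
          | exact ⟨_, ‹_›, ‹_›⟩
          | exact ⟨_, SimpleGraph.Adj.symm ‹_›, SimpleGraph.Adj.symm ‹_›⟩

theorem IsChordal.exists_triangle {V : Type} {G : SimpleGraph V} (hG : IsChordal G) {a b : V}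
    (hab : G.Adj a b) (hbridge : ¬ G.IsBridge s(a, b)) : ∃ c, G.Adj b c ∧ G.Adj c a := by
  rw [SimpleGraph.isBridge_iff_forall_cycle_notMem hab] at hbridge
  push Not at hbridge
  obtain ⟨u, p, hp, he⟩ := hbridge
  exact hG.exists_triangle_of_mem_edges_cycle p hp he

/-- A `ZMod 4`-valued flow on `G`: a skew-symmetric function supported on adjacent pairs and
conserved at every vertex. -/
structure SimpleGraph.IsZMod4Flow {V : Type*} [Fintype V] (G : SimpleGraph V)
    (f : V → V → ZMod 4) : Prop where
  skew : ∀ u v, f u v = -f v u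
  support : ∀ u v, ¬ G.Adj u v → f u v = 0
  conserved : ∀ v, ∑ u, f v u = 0

/-- Adding a suitable constant around a triangle makes a flow nonzero on its three edges without
changing it elsewhere. -/
theorem SimpleGraph.IsZMod4Flow.exists_ne_zero_on_triangle {V : Type*} [Fintype V]
    {G : SimpleGraph V} {f : V → V → ZMod 4} (hf : G.IsZMod4Flow f) {a b c : V} (hab : G.Adj a b)
    (hbc : G.Adj b c) (hca : G.Adj c a) :
    ∃ g, G.IsZMod4Flow g ∧ (∀ u v, f u v ≠ 0 → g u v ≠ 0) ∧ g a b ≠ 0 := by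
  classical
  obtain ⟨t, hx, hy, hz⟩ : ∃ t : ZMod 4, f a b + t ≠ 0 ∧ f b c + t ≠ 0 ∧ f c a + t ≠ 0 := by
    generalize f a b = x
    generalize f b c = y
    generalize f c a = z
    revert x y z
    decide
  let arc (x y u v : V) : ZMod 4 := (if u = x ∧ v = y then t else 0) - if u = y ∧ v = x then t else 0
  have arc_skew (x y u v : V) : arc x y u v = -arc x y v u := by
    simp only [arc, neg_sub, and_comm]
  have arc_sum (x y u : V) :
      ∑ v, arc x y u v = (if u = x then t else 0) - if u = y then t else 0 := by
    simp [arc, Finset.sum_sub_distrib, ite_and]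
  have hne₁ := hab.ne
  have hne₂ := hbc.ne
  have hne₃ := hca.ne
  refine ⟨fun u v => f u v + (arc a b u v + arc b c u v + arc c a u v), ⟨?_, ?_, ?_⟩, ?_, ?_⟩
  · intro u v
    rw [hf.skew u v, arc_skew a b u v, arc_skew b c u v, arc_skew c a u v]
    ring
  · intro u v huv
    have h₁ := hab.symm
    have h₂ := hbc.symm
    have h₃ := hca.symm
    have := hf.support u v huv
    simp only [arc]
    grind
  · intro v
    simp only [Finset.sum_add_distrib, hf.conserved, arc_sum]
    ring
  · intro u v huv
    have h₁ := hf.skew b a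
    have h₂ := hf.skew c b
    have h₃ := hf.skew a c
    simp only [arc]
    grind
  · simp only [arc]
    grind

/-- Every bridgeless chordal graph admits a nowhere-zero 4-flow, formalized via a
skew-symmetric `ZMod 4`-valued function supported exactly on adjacent pairs
(which encodes an orientation together with a nowhere-zero flow). -/
theorem bridgeless_chordal_four_flowing {V : Type} [Fintype V] (G : SimpleGraph V)
    (hbridge : ∀ e : Sym2 V, ¬ G.IsBridge e) (hchordal : IsChordal G) :
    ∃ f : V → V → ZMod 4,
      (∀ u v, f u v = - f v u) ∧
      (∀ u v, G.Adj u v → f u v ≠ 0) ∧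
      (∀ u v, ¬ G.Adj u v → f u v = 0) ∧
      (∀ v, ∑ u : V, f v u = 0) := by
  classical
  have key (S : Finset (V × V)) :
      ∃ f, G.IsZMod4Flow f ∧ ∀ e ∈ S, G.Adj e.1 e.2 → f e.1 e.2 ≠ 0 := by
    induction S using Finset.induction_on with
    | empty => exact ⟨0, ⟨by simp, by simp, by simp⟩, by simp⟩
    | insert e S _ ih =>
      obtain ⟨f, hf, hS⟩ := ih
      by_cases he : G.Adj e.1 e.2
      · obtain ⟨c, hbc, hca⟩ := hchordal.exists_triangle he (hbridge _)
        obtain ⟨g, hg, hfg, hge⟩ := hf.exists_ne_zero_on_triangle he hbc hca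
        refine ⟨g, hg, fun e' he' hadj => ?_⟩
        rcases Finset.mem_insert.mp he' with rfl | h
        · exact hge
        · exact hfg _ _ (hS e' h hadj)
      · refine ⟨f, hf, fun e' he' hadj => ?_⟩
        rcases Finset.mem_insert.mp he' with rfl | h
        · exact absurd hadj he
        · exact hS e' h hadj
  obtain ⟨f, hf, hne⟩ := key Finset.univ
  exact ⟨f, hf.skew, fun u v h => hne (u, v) (Finset.mem_univ _) h, hf.support, hf.conserved⟩
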